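/- Let H ∈ (1/4,1/2) and T > 0, and let σ : [0,T]×ℝ×ℝ → ℝ satisfy: σ(t,x,0) = 0; σ has continuous partial derivatives ∂_x σ, ∂_u σ, ∂²_{xu} σ; and there is C > 0 with sup_{t,x,u} |∂_u σ(t,x,u)| ≤ C and sup_{t,x,u} |∂²_{xu} σ(t,x,u)| ≤ C. Let u : [0,T]×ℝ → ℝ be continuous with ‖u‖_{Z²(T)} < ∞. Then for every t ∈ [0,T]: ∫_0^t ∫_ℝ ‖ G(t−s, x−·)·σ(s, ·, u(s,·)) ‖²_𝓗 dx ds < ∞; consequently, for every t ∈ [0,T] and almost every x ∈ ℝ, ∫_0^t ‖ G(t−s, x−·)·σ(s, ·, u(s,·)) ‖²_𝓗 ds < ∞. -/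

import Mathlib

open MeasureTheory

/-- The one-dimensional wave kernel `G(t,x) = (1/2)·1_{|x|<t}`. -/
noncomputable def G (t x : ℝ) : ℝ := if |x| < t then 1 / 2 else 0

/-- The constant `c_{2,H}`. -/
noncomputable def c2H (H : ℝ) : ℝ :=
  H ^ ((1 : ℝ) / 2) * ((1 : ℝ) / 2 - H) ^ ((1 : ℝ) / 2) * (Real.Gamma (H + 1 / 2))⁻¹ *
    ((∫ t in Set.Ioi (0 : ℝ), ((1 + t) ^ (H - 1 / 2) - t ^ (H - 1 / 2)) ^ 2) + 1 / (2 * H))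
      ^ ((1 : ℝ) / 2)

/-- The squared `𝓗`-norm `‖φ‖²_𝓗 = c_{2,H} ∫∫ |φ(z+h) − φ(z)|² |h|^{2H−2} dz dh`. -/
noncomputable def HnormSq (H : ℝ) (φ : ℝ → ℝ) : ENNReal :=
  ENNReal.ofReal (c2H H) *
    ∫⁻ h : ℝ, ∫⁻ z : ℝ, ENNReal.ofReal ((φ (z + h) - φ z) ^ 2 * |h| ^ (2 * H - 2))

/-- The `Z^p(T)`-norm (valued in `ℝ≥0∞`). -/
noncomputable def Znorm (H p T : ℝ) (v : ℝ → ℝ → ℝ) : ENNReal :=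
  (⨆ t ∈ Set.Icc (0 : ℝ) T, eLpNorm (v t) (ENNReal.ofReal p) volume) +
    ⨆ t ∈ Set.Icc (0 : ℝ) T,
      (∫⁻ h : ℝ, (eLpNorm (fun x => v t (x + h) - v t x) (ENNReal.ofReal p) volume) ^ 2 *
          ENNReal.ofReal (|h| ^ (2 * H - 2))) ^ ((1 : ℝ) / 2)

/-- The wave kernel is jointly measurable. -/
lemma measurable_G : Measurable (fun p : ℝ × ℝ => G p.1 p.2) :=
  Measurable.ite (measurableSet_lt (by fun_prop) (by fun_prop)) measurable_const measurable_const

lemma measurable_G_comp {α : Type*} [MeasurableSpace α] {f g : α → ℝ} (hf : Measurable f)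
    (hg : Measurable g) : Measurable (fun a => G (f a) (g a)) :=
  measurable_G.comp (hf.prodMk hg)

lemma lintegral_G_sq_le {r T : ℝ} (hr : r ≤ T) :
    ∫⁻ y : ℝ, ENNReal.ofReal (G r y ^ 2) ≤ ENNReal.ofReal T := by
  have hG : (fun y : ℝ => ENNReal.ofReal (G r y ^ 2)) =
      (Set.Ioo (-r) r).indicator (fun _ => ENNReal.ofReal (1 / 4)) := by
    funext y
    by_cases hy : |y| < r
    · rw [Set.indicator_of_mem (Set.mem_Ioo.mpr (abs_lt.mp hy))]
      simp only [G, if_pos hy]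
      norm_num
    · rw [Set.indicator_of_notMem (fun h => hy (abs_lt.mpr (Set.mem_Ioo.mp h)))]
      simp [G, if_neg hy]
  rw [hG, lintegral_indicator measurableSet_Ioo, setLIntegral_const, Real.volume_Ioo,
    ← ENNReal.ofReal_mul (by norm_num)]
  rcases le_total r 0 with h | h
  · rw [ENNReal.ofReal_of_nonpos (by linarith)]
    exact zero_le
  · exact ENNReal.ofReal_le_ofReal (by linarith)

lemma lintegral_G_sub_sq_le_abs (r h : ℝ) :
    ∫⁻ y : ℝ, ENNReal.ofReal ((G r (y - h) - G r y) ^ 2) ≤ ENNReal.ofReal |h| := by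
  set S : Set ℝ := Set.Icc (r - |h|) (r + |h|) ∪ Set.Icc (-r - |h|) (-r + |h|) with hS
  have hle : ∀ y : ℝ, ENNReal.ofReal ((G r (y - h) - G r y) ^ 2) ≤
      S.indicator (fun _ => ENNReal.ofReal (1 / 4)) y := by
    intro y
    by_cases hy : y ∈ S
    · rw [Set.indicator_of_mem hy]
      apply ENNReal.ofReal_le_ofReal
      unfold G
      split_ifs <;> norm_num
    · have hGy : G r (y - h) = G r y := by
        have : |y - h| < r ↔ |y| < r := by
          simp only [hS, Set.mem_union, Set.mem_Icc, not_or, not_and_or, not_le] at hy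
          have h1 := le_abs_self h
          have h2 := neg_abs_le h
          rw [abs_lt, abs_lt]
          constructor <;> rintro ⟨h3, h4⟩ <;> constructor <;> by_contra hcon <;>
            rcases hy with ⟨h5 | h5, h6 | h6⟩ <;> linarith
        simp only [G, this]
      rw [hGy]
      simp
  have hvol : volume S ≤ ENNReal.ofReal (4 * |h|) := by
    refine (measure_union_le _ _).trans ?_
    rw [Real.volume_Icc, Real.volume_Icc, ← ENNReal.ofReal_add] <;>
      first
      | exact ENNReal.ofReal_le_ofReal (by linarith)
      | linarith [abs_nonneg h]
  calc ∫⁻ y : ℝ, ENNReal.ofReal ((G r (y - h) - G r y) ^ 2)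
      ≤ ∫⁻ y : ℝ, S.indicator (fun _ => ENNReal.ofReal (1 / 4)) y := lintegral_mono hle
    _ = ENNReal.ofReal (1 / 4) * volume S := by
        rw [lintegral_indicator (measurableSet_Icc.union measurableSet_Icc), setLIntegral_const]
    _ ≤ ENNReal.ofReal (1 / 4) * ENNReal.ofReal (4 * |h|) := by gcongr
    _ = ENNReal.ofReal |h| := by
        rw [← ENNReal.ofReal_mul (by norm_num)]
        congr 1
        ring

lemma lintegral_G_sub_sq_le {r T : ℝ} (hT : 0 ≤ T) (hr : r ≤ T) (h : ℝ) :
    ∫⁻ y : ℝ, ENNReal.ofReal ((G r (y - h) - G r y) ^ 2) ≤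
      ENNReal.ofReal (1 + 4 * T) * ENNReal.ofReal (min 1 |h|) := by
  rw [← ENNReal.ofReal_mul (by linarith)]
  rcases le_total |h| 1 with h1 | h1
  · refine (lintegral_G_sub_sq_le_abs r h).trans (ENNReal.ofReal_le_ofReal ?_)
    rw [min_eq_right h1]
    nlinarith [abs_nonneg h, mul_nonneg hT (abs_nonneg h)]
  · have hm : Measurable (fun y : ℝ => ENNReal.ofReal (G r y ^ 2)) :=
      ((measurable_G_comp measurable_const measurable_id).pow_const 2).ennreal_ofReal
    have hm' : Measurable (fun y : ℝ => ENNReal.ofReal (G r (y - h) ^ 2)) :=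
      hm.comp (measurable_id.sub_const h)
    calc ∫⁻ y : ℝ, ENNReal.ofReal ((G r (y - h) - G r y) ^ 2)
        ≤ ∫⁻ y : ℝ, (2 * ENNReal.ofReal (G r (y - h) ^ 2) + 2 * ENNReal.ofReal (G r y ^ 2)) := by
          refine lintegral_mono fun y => ?_
          have h2 : (2 : ENNReal) = ENNReal.ofReal 2 := by simp
          rw [h2, ← ENNReal.ofReal_mul (by norm_num), ← ENNReal.ofReal_mul (by norm_num),
            ← ENNReal.ofReal_add (by positivity) (by positivity)]
          exact ENNReal.ofReal_le_ofReal (by nlinarith [sq_nonneg (G r (y - h) + G r y)])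
      _ = 2 * (∫⁻ y : ℝ, ENNReal.ofReal (G r y ^ 2)) +
            2 * ∫⁻ y : ℝ, ENNReal.ofReal (G r y ^ 2) := by
          rw [lintegral_add_left (hm'.const_mul 2), lintegral_const_mul _ hm',
            lintegral_const_mul _ hm,
            lintegral_sub_right_eq_self (fun y => ENNReal.ofReal (G r y ^ 2)) h]
      _ ≤ 2 * ENNReal.ofReal T + 2 * ENNReal.ofReal T := by
          gcongr <;> exact lintegral_G_sq_le hr
      _ = ENNReal.ofReal (4 * T) := by
          have h2 : (2 : ENNReal) = ENNReal.ofReal 2 := by simp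
          rw [h2, ← ENNReal.ofReal_mul (by norm_num), ← ENNReal.ofReal_add (by positivity)
            (by positivity)]
          congr 1
          ring
      _ ≤ ENNReal.ofReal ((1 + 4 * T) * min 1 |h|) := by
          rw [min_eq_left h1]
          exact ENNReal.ofReal_le_ofReal (by linarith)

lemma lintegral_rpow_mul_min_lt_top {H : ℝ} (hH0 : 0 < H) (hH1 : H < 1 / 2) :
    ∫⁻ h : ℝ, ENNReal.ofReal (|h| ^ (2 * H - 2)) * ENNReal.ofReal (min 1 |h|) < ⊤ := by
  set g : ℝ → ℝ := fun h => |h| ^ (2 * H - 2) * min 1 |h| with hg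
  have hIoc : IntegrableOn g (Set.Ioc 0 1) := by
    have h1 : IntegrableOn (fun x : ℝ => x ^ (2 * H - 1)) (Set.Ioc 0 1) :=
      (intervalIntegrable_iff_integrableOn_Ioc_of_le zero_le_one).mp
        (intervalIntegral.intervalIntegrable_rpow' (by linarith))
    refine h1.congr_fun (fun x hx => ?_) measurableSet_Ioc
    simp only [hg, abs_of_pos hx.1, min_eq_right hx.2]
    rw [show 2 * H - 1 = (2 * H - 2) + 1 by ring, Real.rpow_add_one hx.1.ne']
  have hIoi1 : IntegrableOn g (Set.Ioi 1) := by
    refine (integrableOn_Ioi_rpow_of_lt (a := 2 * H - 2) (by linarith) one_pos).congr_fun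
      (fun x hx => ?_) measurableSet_Ioi
    have hx : 1 < x := hx
    simp only [hg, abs_of_pos (one_pos.trans hx), min_eq_left hx.le, mul_one]
  have hIoi : IntegrableOn g (Set.Ioi 0) := by
    rw [← Set.Ioc_union_Ioi_eq_Ioi zero_le_one]
    exact hIoc.union hIoi1
  have hIic : IntegrableOn g (Set.Iic 0) := by
    rw [integrableOn_Iic_iff_integrableOn_Iio]
    have h := hIoi.comp_neg
    simpa [hg] using h
  have hint : Integrable g := by
    rw [← integrableOn_univ, ← Set.Iic_union_Ioi (a := (0 : ℝ))]
    exact hIic.union hIoi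
  refine lt_of_eq_of_lt (lintegral_congr fun h => ?_) hint.lintegral_lt_top
  rw [← ENNReal.ofReal_mul (by positivity)]

/-- A measurable majorant of the integrand of the `𝓗`-norm of `z ↦ G r (x - z) * f z` for
functions `f` controlled by `v`. -/
noncomputable def waveMajorant (H C r : ℝ) (v : ℝ → ℝ) (x h z : ℝ) : ENNReal :=
  ENNReal.ofReal (16 * C ^ 2) * (ENNReal.ofReal (|h| ^ (2 * H - 2)) *
    (ENNReal.ofReal (G r (x - z - h) ^ 2) *
      (ENNReal.ofReal (min 1 |h|) * ENNReal.ofReal (v (z + h) ^ 2) +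
        ENNReal.ofReal ((v (z + h) - v z) ^ 2)) +
      ENNReal.ofReal ((G r (x - z - h) - G r (x - z)) ^ 2) * ENNReal.ofReal (v z ^ 2)))

lemma measurable_waveMajorant {α : Type*} [MeasurableSpace α] {H C : ℝ} {r x h z : α → ℝ}
    {v : α → ℝ → ℝ} (hr : Measurable r) (hx : Measurable x) (hh : Measurable h)
    (hz : Measurable z) (hv : Measurable (Function.uncurry v)) :
    Measurable (fun a => waveMajorant H C (r a) (v a) (x a) (h a) (z a)) := by
  have hv1 : Measurable fun a => v a (z a) := hv.comp (measurable_id.prodMk hz)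
  have hv2 : Measurable fun a => v a (z a + h a) := hv.comp (measurable_id.prodMk (hz.add hh))
  have hG1 : Measurable fun a => G (r a) (x a - z a) := measurable_G_comp hr (hx.sub hz)
  have hG2 : Measurable fun a => G (r a) (x a - z a - h a) := measurable_G_comp hr ((hx.sub hz).sub hh)
  unfold waveMajorant
  fun_prop

lemma sq_mul_sub_mul_le_waveMajorant {H C r : ℝ} {f v : ℝ → ℝ}
    (hf : ∀ z, |f z| ≤ C * |v z|)
    (hfd : ∀ z h, |f (z + h) - f z| ≤ C * (min 2 |h|) * |v (z + h)| + C * |v (z + h) - v z|)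
    (x h z : ℝ) :
    ENNReal.ofReal ((G r (x - (z + h)) * f (z + h) - G r (x - z) * f z) ^ 2 *
      |h| ^ (2 * H - 2)) ≤ waveMajorant H C r v x h z := by
  have hm0 : 0 ≤ min 1 |h| := by positivity
  unfold waveMajorant
  rw [← ENNReal.ofReal_mul (by positivity), ← ENNReal.ofReal_add (by positivity) (by positivity),
    ← ENNReal.ofReal_mul (by positivity), ← ENNReal.ofReal_mul (by positivity),
    ← ENNReal.ofReal_add (by positivity) (by positivity), ← ENNReal.ofReal_mul (by positivity),
    ← ENNReal.ofReal_mul (by positivity), sub_add_eq_sub_sub]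
  apply ENNReal.ofReal_le_ofReal
  set a := G r (x - z - h)
  set b := G r (x - z)
  set m := min 1 |h| with hm
  have hmin : (min 2 |h|) ^ 2 ≤ 4 * m := by
    have h0 := abs_nonneg h
    rw [hm]
    rcases le_total |h| 1 with h1 | h1
    · rw [min_eq_right h1, min_eq_right (h1.trans one_le_two)]
      nlinarith
    · rw [min_eq_left h1]
      nlinarith [min_le_left 2 |h|, le_min zero_le_two h0]
  have h0 : f z ^ 2 ≤ C ^ 2 * v z ^ 2 := by
    have := pow_le_pow_left₀ (abs_nonneg _) (hf z) 2
    rwa [mul_pow, sq_abs, sq_abs] at this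
  have h1 : (f (z + h) - f z) ^ 2 ≤
      8 * C ^ 2 * (m * v (z + h) ^ 2 + (v (z + h) - v z) ^ 2) := by
    have h2 := pow_le_pow_left₀ (abs_nonneg _) (hfd z h) 2
    rw [sq_abs] at h2
    have h3 : (C * min 2 |h| * |v (z + h)| + C * |v (z + h) - v z|) ^ 2 ≤
        2 * (C ^ 2 * (min 2 |h|) ^ 2 * v (z + h) ^ 2) + 2 * (C ^ 2 * (v (z + h) - v z) ^ 2) := by
      rw [← sq_abs (v (z + h)), ← sq_abs (v (z + h) - v z)]
      nlinarith [sq_nonneg (C * min 2 |h| * |v (z + h)| - C * |v (z + h) - v z|)]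
    have h4 : C ^ 2 * (min 2 |h|) ^ 2 * v (z + h) ^ 2 ≤ C ^ 2 * (4 * m) * v (z + h) ^ 2 := by
      gcongr
    nlinarith [mul_nonneg (sq_nonneg C) (sq_nonneg (v (z + h) - v z))]
  have h5 : (a * f (z + h) - b * f z) ^ 2 ≤
      2 * (a ^ 2 * (f (z + h) - f z) ^ 2) + 2 * ((a - b) ^ 2 * f z ^ 2) := by
    nlinarith [sq_nonneg (a * (f (z + h) - f z) - (a - b) * f z)]
  have h6 : a ^ 2 * (f (z + h) - f z) ^ 2 ≤
      a ^ 2 * (8 * C ^ 2 * (m * v (z + h) ^ 2 + (v (z + h) - v z) ^ 2)) := by gcongr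
  have h7 : (a - b) ^ 2 * f z ^ 2 ≤ (a - b) ^ 2 * (C ^ 2 * v z ^ 2) := by gcongr
  have h8 : 0 ≤ (a - b) ^ 2 * (C ^ 2 * v z ^ 2) := by positivity
  calc (a * f (z + h) - b * f z) ^ 2 * |h| ^ (2 * H - 2)
      ≤ (16 * C ^ 2 * (a ^ 2 * (m * v (z + h) ^ 2 + (v (z + h) - v z) ^ 2) +
          (a - b) ^ 2 * v z ^ 2)) * |h| ^ (2 * H - 2) := by
        gcongr
        linarith
    _ = _ := by ring

lemma lintegral_waveMajorant_le {H C r T : ℝ} (hT : 0 ≤ T) (hr : r ≤ T) (v : ℝ → ℝ)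
    (h z : ℝ) :
    ∫⁻ x : ℝ, waveMajorant H C r v x h z ≤
      ENNReal.ofReal (16 * C ^ 2) * ENNReal.ofReal (1 + 4 * T) *
        (ENNReal.ofReal (|h| ^ (2 * H - 2)) * ENNReal.ofReal (min 1 |h|) *
            (ENNReal.ofReal (v (z + h) ^ 2) + ENNReal.ofReal (v z ^ 2)) +
          ENNReal.ofReal (|h| ^ (2 * H - 2)) * ENNReal.ofReal ((v (z + h) - v z) ^ 2)) := by
  have hG0 : Measurable (fun y : ℝ => G r y) := measurable_G_comp measurable_const measurable_id
  have hG1 : Measurable (fun x : ℝ => ENNReal.ofReal (G r (x - z - h) ^ 2)) :=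
    ((hG0.comp (by fun_prop : Measurable fun x : ℝ => x - z - h)).pow_const 2).ennreal_ofReal
  have hG2 : Measurable (fun x : ℝ => ENNReal.ofReal ((G r (x - z - h) - G r (x - z)) ^ 2)) :=
    (((hG0.comp (by fun_prop : Measurable fun x : ℝ => x - z - h)).sub
      (hG0.comp (by fun_prop : Measurable fun x : ℝ => x - z))).pow_const 2).ennreal_ofReal
  have hI1 : ∫⁻ x : ℝ, ENNReal.ofReal (G r (x - z - h) ^ 2) ≤ ENNReal.ofReal (1 + 4 * T) := by
    rw [lintegral_sub_right_eq_self (fun y => ENNReal.ofReal (G r (y - h) ^ 2)) z,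
      lintegral_sub_right_eq_self (fun y => ENNReal.ofReal (G r y ^ 2)) h]
    exact (lintegral_G_sq_le hr).trans (ENNReal.ofReal_le_ofReal (by linarith))
  have hI2 : ∫⁻ x : ℝ, ENNReal.ofReal ((G r (x - z - h) - G r (x - z)) ^ 2) ≤
      ENNReal.ofReal (1 + 4 * T) * ENNReal.ofReal (min 1 |h|) := by
    rw [lintegral_sub_right_eq_self (fun y => ENNReal.ofReal ((G r (y - h) - G r y) ^ 2)) z]
    exact lintegral_G_sub_sq_le hT hr h
  unfold waveMajorant
  rw [lintegral_const_mul _ (by fun_prop), lintegral_const_mul _ (by fun_prop),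
    lintegral_add_left (by fun_prop), lintegral_mul_const _ hG1, lintegral_mul_const _ hG2]
  refine (mul_le_mul_right (mul_le_mul_right (add_le_add (mul_le_mul_left hI1 _)
    (mul_le_mul_left hI2 _)) _) _).trans (le_of_eq ?_)
  ring

/-- The space-time bound behind the finiteness of the `𝓗`-norm of the wave kernel times `f`. -/
lemma lintegral_lintegral_lintegral_waveMajorant_le {H C r T : ℝ} (hT : 0 ≤ T) (hr : r ≤ T)
    {v : ℝ → ℝ} (hv : Measurable v) {E Q : ENNReal}
    (hE : ∫⁻ z, ENNReal.ofReal (v z ^ 2) ≤ E)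
    (hQ : ∫⁻ h : ℝ, (∫⁻ z, ENNReal.ofReal ((v (z + h) - v z) ^ 2)) *
      ENNReal.ofReal (|h| ^ (2 * H - 2)) ≤ Q) :
    ∫⁻ x : ℝ, ∫⁻ h : ℝ, ∫⁻ z : ℝ, waveMajorant H C r v x h z ≤
      ENNReal.ofReal (16 * C ^ 2) * ENNReal.ofReal (1 + 4 * T) *
        ((∫⁻ h : ℝ, ENNReal.ofReal (|h| ^ (2 * H - 2)) * ENNReal.ofReal (min 1 |h|)) * (E + E)
          + Q) := by
  have hm3 : Measurable (fun p : (ℝ × ℝ) × ℝ => waveMajorant H C r v p.1.1 p.1.2 p.2) :=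
    measurable_waveMajorant (v := fun _ => v) measurable_const (by fun_prop) (by fun_prop)
      (by fun_prop) (hv.comp measurable_snd)
  have hD : Measurable (fun p : ℝ × ℝ => ENNReal.ofReal ((v (p.2 + p.1) - v p.2) ^ 2)) := by
    fun_prop
  have hDi : Measurable (fun h : ℝ => ∫⁻ z, ENNReal.ofReal ((v (z + h) - v z) ^ 2)) :=
    hD.lintegral_prod_right'
  have hV : Measurable (fun z => ENNReal.ofReal (v z ^ 2)) := by fun_prop
  calc ∫⁻ x : ℝ, ∫⁻ h : ℝ, ∫⁻ z : ℝ, waveMajorant H C r v x h z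
      = ∫⁻ h : ℝ, ∫⁻ x : ℝ, ∫⁻ z : ℝ, waveMajorant H C r v x h z :=
        lintegral_lintegral_swap hm3.lintegral_prod_right'.aemeasurable
    _ = ∫⁻ h : ℝ, ∫⁻ z : ℝ, ∫⁻ x : ℝ, waveMajorant H C r v x h z := by
        refine lintegral_congr fun h => lintegral_lintegral_swap ?_
        exact (measurable_waveMajorant (v := fun _ => v) measurable_const (by fun_prop) (by fun_prop)
          (by fun_prop) (hv.comp measurable_snd)).aemeasurable
    _ ≤ ∫⁻ h : ℝ, ∫⁻ z : ℝ, ENNReal.ofReal (16 * C ^ 2) * ENNReal.ofReal (1 + 4 * T) *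
        (ENNReal.ofReal (|h| ^ (2 * H - 2)) * ENNReal.ofReal (min 1 |h|) *
            (ENNReal.ofReal (v (z + h) ^ 2) + ENNReal.ofReal (v z ^ 2)) +
          ENNReal.ofReal (|h| ^ (2 * H - 2)) * ENNReal.ofReal ((v (z + h) - v z) ^ 2)) :=
        lintegral_mono fun h => lintegral_mono fun z => lintegral_waveMajorant_le hT hr v h z
    _ ≤ ∫⁻ h : ℝ, ENNReal.ofReal (16 * C ^ 2) * ENNReal.ofReal (1 + 4 * T) *
        (ENNReal.ofReal (|h| ^ (2 * H - 2)) * ENNReal.ofReal (min 1 |h|) * (E + E) +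
          (∫⁻ z, ENNReal.ofReal ((v (z + h) - v z) ^ 2)) *
            ENNReal.ofReal (|h| ^ (2 * H - 2))) := by
        refine lintegral_mono fun h => ?_
        rw [lintegral_const_mul _ (by fun_prop), lintegral_add_left (by fun_prop),
          lintegral_const_mul _ (by fun_prop), lintegral_const_mul _ (by fun_prop),
          lintegral_add_left (by fun_prop),
          lintegral_add_right_eq_self (fun z => ENNReal.ofReal (v z ^ 2)) h,
          mul_comm (∫⁻ z, ENNReal.ofReal ((v (z + h) - v z) ^ 2))]
        gcongr
    _ = ENNReal.ofReal (16 * C ^ 2) * ENNReal.ofReal (1 + 4 * T) *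
        ((∫⁻ h : ℝ, ENNReal.ofReal (|h| ^ (2 * H - 2)) * ENNReal.ofReal (min 1 |h|)) * (E + E) +
          ∫⁻ h : ℝ, (∫⁻ z, ENNReal.ofReal ((v (z + h) - v z) ^ 2)) *
            ENNReal.ofReal (|h| ^ (2 * H - 2))) := by
        rw [lintegral_const_mul _ (by fun_prop), lintegral_add_left (by fun_prop),
          lintegral_mul_const _ (by fun_prop)]
    _ ≤ _ := by gcongr

lemma eLpNorm_ofReal_two_sq (f : ℝ → ℝ) :
    eLpNorm f (ENNReal.ofReal 2) volume ^ 2 = ∫⁻ z, ENNReal.ofReal (f z ^ 2) := by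
  have h2 : ENNReal.ofReal 2 = ((2 : NNReal) : ENNReal) := by simp
  have h := eLpNorm_nnreal_pow_eq_lintegral (μ := volume) (f := f) (p := 2) two_ne_zero
  rw [h2]
  simp only [NNReal.coe_ofNat, ENNReal.rpow_ofNat] at h
  rw [h]
  refine lintegral_congr fun z => ?_
  rw [← sq_abs, ENNReal.ofReal_pow (abs_nonneg _), ← Real.norm_eq_abs, ofReal_norm]

lemma lintegral_sq_le_Znorm_sq {H T t : ℝ} (ht : t ∈ Set.Icc 0 T) (v : ℝ → ℝ → ℝ) :
    ∫⁻ z, ENNReal.ofReal (v t z ^ 2) ≤ Znorm H 2 T v ^ 2 := by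
  rw [← eLpNorm_ofReal_two_sq]
  gcongr
  exact (le_iSup₂ (f := fun t (_ : t ∈ Set.Icc (0 : ℝ) T) =>
    eLpNorm (v t) (ENNReal.ofReal 2) volume) t ht).trans le_self_add

lemma lintegral_sub_sq_le_Znorm_sq {H T t : ℝ} (ht : t ∈ Set.Icc 0 T) (v : ℝ → ℝ → ℝ) :
    ∫⁻ h : ℝ, (∫⁻ z, ENNReal.ofReal ((v t (z + h) - v t z) ^ 2)) *
      ENNReal.ofReal (|h| ^ (2 * H - 2)) ≤ Znorm H 2 T v ^ 2 := by
  have h : (∫⁻ h : ℝ, (eLpNorm (fun x => v t (x + h) - v t x) (ENNReal.ofReal 2) volume) ^ 2 *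
      ENNReal.ofReal (|h| ^ (2 * H - 2))) ^ ((1 : ℝ) / 2) ≤ Znorm H 2 T v :=
    (le_iSup₂ (f := fun t (_ : t ∈ Set.Icc (0 : ℝ) T) => (∫⁻ h : ℝ,
      (eLpNorm (fun x => v t (x + h) - v t x) (ENNReal.ofReal 2) volume) ^ 2 *
        ENNReal.ofReal (|h| ^ (2 * H - 2))) ^ ((1 : ℝ) / 2)) t ht).trans le_add_self
  simp only [eLpNorm_ofReal_two_sq] at h
  have h2 := pow_le_pow_left₀ zero_le h 2
  rwa [← ENNReal.rpow_natCast, ← ENNReal.rpow_mul, show (1 : ℝ) / 2 * ((2 : ℕ) : ℝ) = 1 by norm_num,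
    ENNReal.rpow_one] at h2

/-- A function of two variables vanishing at `u = 0` with bounded `∂_u` and bounded mixed
derivative: its composition with `v` has increments controlled by those of `v`. -/
lemma abs_comp_sub_le {g : ℝ → ℝ → ℝ} {C : ℝ} (hg0 : ∀ x, g x 0 = 0)
    (hdu : ∀ x, Differentiable ℝ (g x))
    (hdxu : ∀ u, Differentiable ℝ (fun x => deriv (g x) u))
    (hbu : ∀ x u, |deriv (g x) u| ≤ C)
    (hbxu : ∀ x u, |deriv (fun x' => deriv (g x') u) x| ≤ C) (v : ℝ → ℝ) (z h : ℝ) :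
    |g (z + h) (v (z + h)) - g z (v z)| ≤
      C * min 2 |h| * |v (z + h)| + C * |v (z + h) - v z| := by
  have hlip : |g z (v (z + h)) - g z (v z)| ≤ C * |v (z + h) - v z| :=
    convex_univ.norm_image_sub_le_of_norm_deriv_le (fun u _ => hdu z u) (fun u _ => hbu z u)
      (Set.mem_univ _) (Set.mem_univ _)
  have hC : 0 ≤ C := (abs_nonneg _).trans (hbu 0 0)
  have hmix : ∀ u, |deriv (g (z + h)) u - deriv (g z) u| ≤ C * min 2 |h| := by
    intro u
    rw [mul_min_of_nonneg _ _ hC]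
    refine le_min ?_ ?_
    · have := abs_sub (deriv (g (z + h)) u) (deriv (g z) u)
      linarith [hbu (z + h) u, hbu z u]
    · have := convex_univ.norm_image_sub_le_of_norm_deriv_le (x := z) (y := z + h)
        (fun x _ => hdxu u x) (fun x _ => hbxu x u) (Set.mem_univ _) (Set.mem_univ _)
      simpa using this
  have hx : |g (z + h) (v (z + h)) - g z (v (z + h))| ≤ C * min 2 |h| * |v (z + h)| := by
    have := convex_univ.norm_image_sub_le_of_norm_deriv_le (x := 0) (y := v (z + h))
      (f := fun u => g (z + h) u - g z u) (C := C * min 2 |h|)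
      (fun u _ => (hdu (z + h) u).sub (hdu z u))
      (fun u _ => by
        rw [deriv_fun_sub (hdu (z + h) u) (hdu z u)]
        exact hmix u) (Set.mem_univ _) (Set.mem_univ _)
    simpa [hg0] using this
  calc |g (z + h) (v (z + h)) - g z (v z)|
      ≤ |g (z + h) (v (z + h)) - g z (v (z + h))| + |g z (v (z + h)) - g z (v z)| :=
        abs_sub_le _ _ _
    _ ≤ _ := add_le_add hx hlip

theorem stmt12 (H T : ℝ) (hH : H ∈ Set.Ioo (1 / 4 : ℝ) (1 / 2 : ℝ)) (hT : 0 < T)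
    (σ : ℝ → ℝ → ℝ → ℝ) (C : ℝ) (hC : 0 < C)
    (hσ0 : ∀ t ∈ Set.Icc (0 : ℝ) T, ∀ x : ℝ, σ t x 0 = 0)
    (hdx : ∀ t ∈ Set.Icc (0 : ℝ) T, ∀ u : ℝ, Differentiable ℝ (fun x => σ t x u))
    (hdu : ∀ t ∈ Set.Icc (0 : ℝ) T, ∀ x : ℝ, Differentiable ℝ (σ t x))
    (hdxu : ∀ t ∈ Set.Icc (0 : ℝ) T, ∀ u : ℝ, Differentiable ℝ (fun x => deriv (σ t x) u))
    (hcx : ContinuousOn (fun p : ℝ × ℝ × ℝ => deriv (fun x => σ p.1 x p.2.2) p.2.1)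
      (Set.Icc (0 : ℝ) T ×ˢ (Set.univ : Set (ℝ × ℝ))))
    (hcu : ContinuousOn (fun p : ℝ × ℝ × ℝ => deriv (σ p.1 p.2.1) p.2.2)
      (Set.Icc (0 : ℝ) T ×ˢ (Set.univ : Set (ℝ × ℝ))))
    (hcxu : ContinuousOn (fun p : ℝ × ℝ × ℝ => deriv (fun x => deriv (σ p.1 x) p.2.2) p.2.1)
      (Set.Icc (0 : ℝ) T ×ˢ (Set.univ : Set (ℝ × ℝ))))
    (hbu : ∀ t ∈ Set.Icc (0 : ℝ) T, ∀ x u : ℝ, |deriv (σ t x) u| ≤ C)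
    (hbxu : ∀ t ∈ Set.Icc (0 : ℝ) T, ∀ x u : ℝ,
      |deriv (fun x' => deriv (σ t x') u) x| ≤ C)
    (u : ℝ → ℝ → ℝ)
    (hucont : ContinuousOn (fun q : ℝ × ℝ => u q.1 q.2)
      (Set.Icc (0 : ℝ) T ×ˢ (Set.univ : Set ℝ)))
    (huZ : Znorm H 2 T u < ⊤) :
    (∀ t ∈ Set.Icc (0 : ℝ) T,
      (∫⁻ s in Set.Icc (0 : ℝ) t, ∫⁻ x : ℝ,
          HnormSq H (fun z => G (t - s) (x - z) * σ s z (u s z))) < ⊤) ∧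
    (∀ t ∈ Set.Icc (0 : ℝ) T, ∀ᵐ x : ℝ,
      (∫⁻ s in Set.Icc (0 : ℝ) t,
          HnormSq H (fun z => G (t - s) (x - z) * σ s z (u s z))) < ⊤) := by
  set w : ℝ → ℝ → ℝ := fun s z => u (Set.projIcc 0 T hT.le s) z with hw
  have hwu : ∀ s ∈ Set.Icc (0 : ℝ) T, w s = u s := fun s hs => by
    simp only [hw, Set.projIcc_of_mem hT.le hs]
  have hwc : Continuous (Function.uncurry w) :=
    hucont.comp_continuous (f := fun q : ℝ × ℝ => ((Set.projIcc 0 T hT.le q.1 : ℝ), q.2))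
      (((continuous_subtype_val.comp continuous_projIcc).comp continuous_fst).prodMk
        continuous_snd) (fun q => ⟨Subtype.prop _, Set.mem_univ _⟩)
  set M : ℝ → ℝ → ℝ → ENNReal := fun t s x =>
    ENNReal.ofReal (c2H H) * ∫⁻ h : ℝ, ∫⁻ z : ℝ, waveMajorant H C (t - s) (w s) x h z with hM
  have hMm : ∀ t, Measurable (Function.uncurry (M t)) := by
    intro t
    have h1 : Measurable (fun p : ((ℝ × ℝ) × ℝ) × ℝ =>
        waveMajorant H C (t - p.1.1.1) (w p.1.1.1) p.1.1.2 p.1.2 p.2) :=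
      measurable_waveMajorant (by fun_prop) (by fun_prop) (by fun_prop) (by fun_prop)
        (hwc.measurable.comp (g := Function.uncurry w)
          (f := fun q : (((ℝ × ℝ) × ℝ) × ℝ) × ℝ => (q.1.1.1.1, q.2)) (by fun_prop))
    exact h1.lintegral_prod_right'.lintegral_prod_right'.const_mul _
  have hle : ∀ t ∈ Set.Icc (0 : ℝ) T, ∀ s ∈ Set.Icc (0 : ℝ) t, ∀ x,
      HnormSq H (fun z => G (t - s) (x - z) * σ s z (u s z)) ≤ M t s x := by
    intro t ht s hs x
    have hsT : s ∈ Set.Icc (0 : ℝ) T := ⟨hs.1, hs.2.trans ht.2⟩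
    simp only [hM, HnormSq, hwu s hsT]
    gcongr with h z
    refine sq_mul_sub_mul_le_waveMajorant (f := fun z => σ s z (u s z)) (fun z => ?_) (fun z h =>
      abs_comp_sub_le (hσ0 s hsT) (hdu s hsT) (hdxu s hsT) (hbu s hsT) (hbxu s hsT) (u s) z h)
      x h z
    have := convex_univ.norm_image_sub_le_of_norm_deriv_le (x := 0) (y := u s z)
      (fun y _ => hdu s hsT z y) (fun y _ => hbu s hsT z y) (Set.mem_univ _) (Set.mem_univ _)
    simpa [hσ0 s hsT] using this
  have hfin : ∀ t ∈ Set.Icc (0 : ℝ) T, ∫⁻ s in Set.Icc (0 : ℝ) t, ∫⁻ x : ℝ, M t s x < ⊤ := by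
    intro t ht
    set K : ENNReal := ENNReal.ofReal (c2H H) *
      (ENNReal.ofReal (16 * C ^ 2) * ENNReal.ofReal (1 + 4 * T) *
        ((∫⁻ h : ℝ, ENNReal.ofReal (|h| ^ (2 * H - 2)) * ENNReal.ofReal (min 1 |h|)) *
          (Znorm H 2 T u ^ 2 + Znorm H 2 T u ^ 2) + Znorm H 2 T u ^ 2)) with hK
    have hKtop : K < ⊤ := by
      have h1 := lintegral_rpow_mul_min_lt_top (H := H) (by linarith [hH.1]) hH.2
      have h2 : Znorm H 2 T u ^ 2 < ⊤ := ENNReal.pow_lt_top huZ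
      exact ENNReal.mul_lt_top ENNReal.ofReal_lt_top (ENNReal.mul_lt_top
        (ENNReal.mul_lt_top ENNReal.ofReal_lt_top ENNReal.ofReal_lt_top)
        (ENNReal.add_lt_top.mpr ⟨ENNReal.mul_lt_top h1 (ENNReal.add_lt_top.mpr ⟨h2, h2⟩), h2⟩))
    have hMK : ∀ s ∈ Set.Icc (0 : ℝ) t, ∫⁻ x : ℝ, M t s x ≤ K := by
      intro s hs
      have hsT : s ∈ Set.Icc (0 : ℝ) T := ⟨hs.1, hs.2.trans ht.2⟩
      have hv : Measurable (w s) := (hwc.comp (Continuous.prodMk_right s)).measurable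
      simp only [hM]
      rw [lintegral_const_mul' _ _ ENNReal.ofReal_ne_top]
      refine mul_le_mul_right (lintegral_lintegral_lintegral_waveMajorant_le hT.le
        (by linarith [hs.1, ht.2]) hv ?_ ?_) _
      · rw [hwu s hsT]
        exact lintegral_sq_le_Znorm_sq hsT u
      · rw [hwu s hsT]
        exact lintegral_sub_sq_le_Znorm_sq hsT u
    refine (setLIntegral_mono' measurableSet_Icc hMK).trans_lt ?_
    rw [setLIntegral_const, Real.volume_Icc]
    exact ENNReal.mul_lt_top hKtop ENNReal.ofReal_lt_top
  refine ⟨fun t ht => (setLIntegral_mono' measurableSet_Icc fun s hs =>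
    lintegral_mono (hle t ht s hs)).trans_lt (hfin t ht), fun t ht => ?_⟩
  have hswap := hfin t ht
  rw [lintegral_lintegral_swap (hMm t).aemeasurable] at hswap
  filter_upwards [ae_lt_top (hMm t).lintegral_prod_left' hswap.ne] with x hx
  exact (setLIntegral_mono' measurableSet_Icc fun s hs => hle t ht s hs x).trans_lt hx
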